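/- Let v : 2^S → ℝ satisfy gross substitutes, let ℓ ∈ ℕ, and let M ≥ 0. Then the valuation ṽ defined by ṽ(T) = v(T) if |T| ≤ ℓ and ṽ(T) = v(T) − M(|T|−ℓ) otherwise satisfies gross substitutes; likewise the valuation v̄ defined by v̄(T) = v(T) + M|T| if |T| ≤ ℓ and v̄(T) = v(T) + Mℓ − M(|T|−ℓ) otherwise satisfies gross substitutes. -/

import Mathlib

open Finset

variable {S : Type*}

/-- Quasilinear utility of bundle `T` at prices `p`. -/
def qUtil [DecidableEq S] (v : Finset S → ℝ) (p : S → ℝ) (T : Finset S) : ℝ :=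
  v T - ∑ j ∈ T, p j

/-- `T` is a demanded set at prices `p`. -/
def Demands [DecidableEq S] (v : Finset S → ℝ) (p : S → ℝ) (T : Finset S) : Prop :=
  ∀ T' : Finset S, qUtil v p T' ≤ qUtil v p T

/-- Gross substitutes: if prices (weakly) increase, every demanded set keeps, inside some
new demanded set, all its items whose price did not change. -/
def GrossSubstitutes [DecidableEq S] (v : Finset S → ℝ) : Prop :=
  ∀ p p' : S → ℝ, (∀ j, p j ≤ p' j) →
    ∀ T : Finset S, Demands v p T →
      ∃ T' : Finset S, Demands v p' T' ∧ ∀ j ∈ T, p j = p' j → j ∈ T'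

/-- Diminishing marginal values, stated for pairs of items. -/
def PairSubmodular [DecidableEq S] (v : Finset S → ℝ) : Prop :=
  ∀ (A : Finset S) (i j : S), i ∉ A → j ∉ A → i ≠ j →
    v (insert i (insert j A)) + v A ≤ v (insert i A) + v (insert j A)

/-- The three-item exchange condition of Reijnierse, van Gellekom and Potters. -/
def TripleExchange [DecidableEq S] (v : Finset S → ℝ) : Prop :=
  ∀ (A : Finset S) (i j k : S), i ∉ A → j ∉ A → k ∉ A → i ≠ j → i ≠ k → j ≠ k →
    v (insert i (insert j A)) + v (insert k A) ≤ v (insert i (insert k A)) + v (insert j A) ∨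
    v (insert i (insert j A)) + v (insert k A) ≤ v (insert j (insert k A)) + v (insert i A)

lemma eq_empty_or_singleton_of_card_le_one {D : Finset S} (hD : D.card ≤ 1) :
    D = ∅ ∨ ∃ j, D = {j} := by
  rcases Nat.le_one_iff_eq_zero_or_eq_one.1 hD with h | h
  · exact Or.inl (card_eq_zero.1 h)
  · exact Or.inr (card_eq_one.1 h)

section
variable [DecidableEq S] {v : Finset S → ℝ}

lemma qUtil_insert (v : Finset S → ℝ) (p : S → ℝ) {A : Finset S} {i : S} (hi : i ∉ A) :
    qUtil v p (insert i A) = v (insert i A) - p i - ∑ j ∈ A, p j := by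
  rw [qUtil, sum_insert hi]; ring

lemma qUtil_insert_insert (v : Finset S → ℝ) (p : S → ℝ) {A : Finset S} {i j : S} (hi : i ∉ A)
    (hj : j ∉ A) (hij : i ≠ j) :
    qUtil v p (insert i (insert j A)) =
      v (insert i (insert j A)) - p i - p j - ∑ x ∈ A, p x := by
  rw [qUtil, sum_insert (by simp [hij, hi]), sum_insert hj]; ring

lemma PairSubmodular.qUtil (h : PairSubmodular v) (p : S → ℝ) : PairSubmodular (qUtil v p) := by
  intro A i j hi hj hij
  have := h A i j hi hj hij
  rw [qUtil_insert_insert v p hi hj hij, qUtil_insert v p hi, qUtil_insert v p hj, _root_.qUtil]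
  linarith

lemma TripleExchange.qUtil (h : TripleExchange v) (p : S → ℝ) : TripleExchange (qUtil v p) := by
  intro A i j k hi hj hk hij hik hjk
  have := h A i j k hi hj hk hij hik hjk
  rw [qUtil_insert_insert v p hi hj hij, qUtil_insert_insert v p hi hk hik,
    qUtil_insert_insert v p hj hk hjk, qUtil_insert v p hi, qUtil_insert v p hj,
    qUtil_insert v p hk]
  rcases this with h | h
  · left; linarith
  · right; linarith

lemma PairSubmodular.add_card (h : PairSubmodular v) {f : ℕ → ℝ}
    (hf : ∀ n, f (n + 2) + f n ≤ 2 * f (n + 1)) : PairSubmodular fun T => v T + f T.card := by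
  intro A i j hi hj hij
  have h₁ := h A i j hi hj hij
  have h₂ := hf A.card
  have hi' : i ∉ insert j A := by simp [hij, hi]
  simp only [card_insert_of_notMem hi, card_insert_of_notMem hj, card_insert_of_notMem hi']
  linarith

lemma TripleExchange.add_card (h : TripleExchange v) (f : ℕ → ℝ) :
    TripleExchange fun T => v T + f T.card := by
  intro A i j k hi hj hk hij hik hjk
  have hij' : i ∉ insert j A := by simp [hij, hi]
  have hik' : i ∉ insert k A := by simp [hik, hi]
  have hjk' : j ∉ insert k A := by simp [hjk, hj]
  simp only [card_insert_of_notMem hi, card_insert_of_notMem hj, card_insert_of_notMem hk,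
    card_insert_of_notMem hij', card_insert_of_notMem hik', card_insert_of_notMem hjk']
  rcases h A i j k hi hj hk hij hik hjk with h | h
  · left; linarith
  · right; linarith

/-- The four-item exchange condition follows from the three-item one. -/
lemma TripleExchange.quadruple (h : TripleExchange v) {A : Finset S} {a b c d : S}
    (ha : a ∉ A) (hb : b ∉ A) (hc : c ∉ A) (hd : d ∉ A) (hab : a ≠ b) (hac : a ≠ c)
    (had : a ≠ d) (hbc : b ≠ c) (hbd : b ≠ d) (hcd : c ≠ d) :
    v (insert a (insert b A)) + v (insert c (insert d A)) ≤
      v (insert a (insert c A)) + v (insert b (insert d A)) ∨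
    v (insert a (insert b A)) + v (insert c (insert d A)) ≤
      v (insert a (insert d A)) + v (insert b (insert c A)) := by
  have h₁ := h A a b c ha hb hc hab hac hbc
  have h₂ := h A a b d ha hb hd hab had hbd
  have h₃ := h A c d a hc hd ha hcd hac.symm had.symm
  have h₄ := h A c d b hc hd hb hcd hbc.symm hbd.symm
  rw [Finset.insert_comm c a, Finset.insert_comm d a] at h₃
  rw [Finset.insert_comm c b, Finset.insert_comm d b] at h₄
  by_contra! hcon
  obtain ⟨hc₁, hc₂⟩ := hcon
  rcases h₁ with h₁ | h₁ <;> rcases h₂ with h₂ | h₂ <;> rcases h₃ with h₃ | h₃ <;>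
    rcases h₄ with h₄ | h₄ <;> linarith

/-- A uniform form of the local conditions: `D` and `E` are each empty or a single item. -/
lemma local_exchange (hs : PairSubmodular v) (ht : TripleExchange v) {Y D E : Finset S} {a b : S}
    (ha : a ∉ Y) (hb : b ∉ Y) (hab : a ≠ b) (hD : D ⊆ Y) (hE : E ⊆ Y) (hDE : Disjoint D E)
    (hD1 : D.card ≤ 1) (hE1 : E.card ≤ 1) :
    v (insert a (insert b Y \ D) \ E) + v Y ≤ v (insert b Y \ D) + v (insert a Y \ E) ∨
    v (insert a (insert b Y \ D) \ E) + v Y ≤ v (insert b Y \ E) + v (insert a Y \ D) := by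
  rcases eq_empty_or_singleton_of_card_le_one hD1 with rfl | ⟨d, rfl⟩ <;>
    rcases eq_empty_or_singleton_of_card_le_one hE1 with rfl | ⟨e, rfl⟩
  · left
    simp only [sdiff_empty]
    linarith [hs Y a b ha hb hab]
  · have he : e ∈ Y := by simpa using hE
    have key := ht (Y.erase e) a b e (by simp [ha]) (by simp [hb]) (by simp) hab
      (by rintro rfl; exact ha he) (by rintro rfl; exact hb he)
    rw [insert_erase he] at key
    have e₁ : insert a (insert b Y \ ∅) \ {e} = insert a (insert b (Y.erase e)) := by grind
    have e₂ : insert a Y \ {e} = insert a (Y.erase e) := by grind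
    have e₃ : insert b Y \ {e} = insert b (Y.erase e) := by grind
    rw [e₁, e₂, e₃, sdiff_empty, sdiff_empty]
    rcases key with h | h
    · right; linarith
    · left; linarith
  · have hd : d ∈ Y := by simpa using hD
    have key := ht (Y.erase d) a b d (by simp [ha]) (by simp [hb]) (by simp) hab
      (by rintro rfl; exact ha hd) (by rintro rfl; exact hb hd)
    rw [insert_erase hd] at key
    have e₁ : insert a (insert b Y \ {d}) \ ∅ = insert a (insert b (Y.erase d)) := by grind
    have e₂ : insert a Y \ {d} = insert a (Y.erase d) := by grind
    have e₃ : insert b Y \ {d} = insert b (Y.erase d) := by grind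
    rw [e₁, e₂, e₃, sdiff_empty, sdiff_empty]
    rcases key with h | h
    · left; linarith
    · right; linarith
  · have hd : d ∈ Y := by simpa using hD
    have he : e ∈ Y := by simpa using hE
    have hde : d ≠ e := by simpa using hDE
    have hA : insert d (insert e ((Y.erase d).erase e)) = Y := by grind
    have key := ht.quadruple (A := (Y.erase d).erase e) (a := a) (b := b) (c := d) (d := e)
      (by simp [ha]) (by simp [hb]) (by simp) (by simp) hab (by rintro rfl; exact ha hd)
      (by rintro rfl; exact ha he) (by rintro rfl; exact hb hd) (by rintro rfl; exact hb he) hde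
    rw [hA] at key
    have e₁ : insert a (insert b Y \ {d}) \ {e} = insert a (insert b ((Y.erase d).erase e)) := by
      clear key hA; ext x; simp; grind
    have e₂ : insert a Y \ {d} = insert a (insert e ((Y.erase d).erase e)) := by
      clear key hA; ext x; simp; grind
    have e₃ : insert b Y \ {d} = insert b (insert e ((Y.erase d).erase e)) := by
      clear key hA; ext x; simp; grind
    have e₄ : insert a Y \ {e} = insert a (insert d ((Y.erase d).erase e)) := by
      clear key hA; ext x; simp; grind
    have e₅ : insert b Y \ {e} = insert b (insert d ((Y.erase d).erase e)) := by
      clear key hA; ext x; simp; grind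
    rw [e₁, e₂, e₃, e₄, e₅]
    rcases key with h | h
    · left; linarith
    · right; linarith

lemma exists_swap_of_subset (ht : TripleExchange v) {Z : Finset S}
    (hZ : ∀ j ∉ Z, v (insert j Z) = v Z) {i : S} :
    ∀ (n : ℕ) (Y : Finset S), (Y \ Z).card = n + 1 → Z ⊆ Y → i ∉ Y →
      ∃ j ∈ Y \ Z, v Y ≤ v (insert i (Y.erase j)) := by
  intro n
  induction n with
  | zero =>
    intro Y hn hZY hi
    obtain ⟨j, hj⟩ := card_eq_one.1 hn
    have hjm : j ∈ Y \ Z := by simp [hj]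
    refine ⟨j, hjm, ?_⟩
    have hY : Y = insert j Z := by
      rw [← sdiff_union_of_subset hZY, hj]; rfl
    have hjZ : j ∉ Z := (mem_sdiff.1 hjm).2
    rw [hY, erase_insert hjZ, hZ j hjZ, hZ i (fun h => hi (hZY h))]
  | succ n ih =>
    intro Y hn hZY hi
    by_contra! hcon
    obtain ⟨j₀, hj₀, hmax⟩ := exists_max_image (Y \ Z) (fun j => v (Y.erase j))
      (card_pos.1 (by omega))
    have hj₀' := mem_sdiff.1 hj₀
    obtain ⟨j, hj, hle⟩ := ih (Y.erase j₀)
      (by rw [erase_sdiff_comm, card_erase_of_mem hj₀]; omega)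
      (by intro x hx; grind) (by simp [hi])
    have hjj : j ≠ j₀ := by grind
    have hjY : j ∈ Y := by grind
    have hjYZ : j ∈ Y \ Z := by grind
    have key := ht ((Y.erase j₀).erase j) j₀ j i (by simp) (by simp) (by simp [hi]) hjj.symm
      (by rintro rfl; exact hi hj₀'.1) (by rintro rfl; exact hi hjY)
    have e₁ : insert j₀ (insert j ((Y.erase j₀).erase j)) = Y := by grind
    have e₂ : insert j₀ (insert i ((Y.erase j₀).erase j)) = insert i (Y.erase j) := by grind
    have e₃ : insert j (insert i ((Y.erase j₀).erase j)) = insert i (Y.erase j₀) := by grind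
    have e₄ : insert j ((Y.erase j₀).erase j) = Y.erase j₀ := by grind
    have e₅ : insert j₀ ((Y.erase j₀).erase j) = Y.erase j := by grind
    rw [e₁, e₂, e₃, e₄, e₅] at key
    have h₁ := hcon j hjYZ
    have h₂ := hcon j₀ hj₀
    have h₃ := hmax j hjYZ
    rcases key with h | h <;> linarith

lemma exists_exchange_of_normalized (hs : PairSubmodular v) (ht : TripleExchange v) {Z : Finset S}
    (hZ : ∀ j ∉ Z, v (insert j Z) = v Z) {i : S} (hiZ : i ∉ Z) :
    ∀ (n : ℕ) (Y : Finset S), (Y \ Z).card + (Z \ Y).card ≤ n → i ∉ Y →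
      ∃ D ⊆ Y \ Z, D.card ≤ 1 ∧ v Y ≤ v (insert i Y \ D) := by
  intro n
  induction n with
  | zero =>
    intro Y hn hi
    have hYZ : Y = Z := by
      apply Subset.antisymm <;> rw [← sdiff_eq_empty_iff_subset, ← card_eq_zero] <;> omega
    subst hYZ
    exact ⟨∅, by simp, by simp, by simp [hZ i hi]⟩
  | succ n ih =>
    intro Y hn hi
    by_cases hsub : Z ⊆ Y
    · rcases Nat.eq_zero_or_pos (Y \ Z).card with h0 | hpos
      · exact ih Y (by rw [h0, card_eq_zero.2 (sdiff_eq_empty_iff_subset.2 hsub)]; omega) hi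
      · obtain ⟨j, hj, hle⟩ := exists_swap_of_subset ht hZ ((Y \ Z).card - 1) Y (by omega) hsub hi
        refine ⟨{j}, by simpa using hj, by simp, ?_⟩
        rwa [show insert i Y \ {j} = insert i (Y.erase j) by grind]
    · obtain ⟨b, hbZ, hbY⟩ := not_subset.1 hsub
      by_contra! hcon
      obtain ⟨D, hD, hmax⟩ := exists_max_image ((Y \ Z).powerset.filter fun D => D.card ≤ 1)
        (fun D => v (insert b Y \ D)) ⟨∅, by simp⟩
      rw [mem_filter, mem_powerset] at hD
      have hib : i ≠ b := by rintro rfl; exact hiZ hbZ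
      have hc₁ : ((insert b Y \ D) \ Z).card ≤ (Y \ Z).card := card_le_card (by grind)
      have hc₂ : (Z \ (insert b Y \ D)).card < (Z \ Y).card := by
        apply card_lt_card
        refine ⟨by grind, fun h => ?_⟩
        have : b ∈ Z \ (insert b Y \ D) := h (by simp [hbZ, hbY])
        grind
      obtain ⟨E, hE, hE1, hle⟩ := ih (insert b Y \ D) (by omega) (by simp [hib, hi])
      have hEYZ : E ⊆ Y \ Z := by intro x hx; have := hE hx; grind
      have key := local_exchange hs ht (Y := Y) (D := D) (E := E) (a := i) (b := b) hi hbY hib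
        (hD.1.trans sdiff_subset) (hEYZ.trans sdiff_subset)
        (by rw [Finset.disjoint_left]; intro x hx hx'; have := hE hx'; grind) hD.2 hE1
      have h₁ := hcon D hD.1 hD.2
      have h₂ := hcon E hEYZ hE1
      have h₃ := hmax E (by simp [hEYZ, hE1])
      rcases key with h | h <;> linarith

/-- The local conditions imply the M♮-concave exchange property. -/
lemma exists_exchange (hs : PairSubmodular v) (ht : TripleExchange v) {X Y : Finset S} {i : S}
    (hiX : i ∈ X) (hiY : i ∉ Y) :
    ∃ D ⊆ Y \ X, D.card ≤ 1 ∧ v X + v Y ≤ v (X.erase i ∪ D) + v (insert i Y \ D) := by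
  set Z := X.erase i with hZdef
  have hiZ : i ∉ Z := by simp [hZdef]
  have hX : insert i Z = X := insert_erase hiX
  set p : S → ℝ := fun j => v (insert j Z) - v Z with hp
  obtain ⟨D, hD, hD1, hle⟩ := exists_exchange_of_normalized (hs.qUtil p) (ht.qUtil p) (Z := Z)
    (by intro j hj; rw [qUtil_insert v p hj, qUtil, hp]; ring) hiZ _ Y le_rfl hiY
  refine ⟨D, fun x hx => ?_, hD1, ?_⟩
  · have := hD hx
    grind
  have hsum := sum_sdiff (f := p) (show D ⊆ insert i Y by grind)
  rw [sum_insert hiY] at hsum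
  have hpD : ∑ x ∈ D, p x = v (Z ∪ D) - v Z := by
    rcases eq_empty_or_singleton_of_card_le_one hD1 with rfl | ⟨d, rfl⟩
    · simp
    · simp [hp, union_comm Z]
  have hpi : p i = v X - v Z := by rw [← hX]
  simp only [qUtil] at hle
  linarith

lemma exists_demands [Fintype S] (v : Finset S → ℝ) (p : S → ℝ) : ∃ T, Demands v p T := by
  obtain ⟨T, -, hT⟩ := exists_max_image (univ : Finset (Finset S)) (qUtil v p) univ_nonempty
  exact ⟨T, fun T' => hT T' (mem_univ _)⟩

lemma grossSubstitutes_of_local [Fintype S] (hs : PairSubmodular v) (ht : TripleExchange v) :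
    GrossSubstitutes v := by
  classical
  intro p p' hpp T hT
  obtain ⟨T₀, hT₀⟩ := exists_demands v p'
  obtain ⟨T', hT', hmax⟩ := exists_max_image
    ((univ : Finset (Finset S)).filter fun T' => Demands v p' T')
    (fun T' => ((T ∩ T').filter fun j => p j = p' j).card) ⟨T₀, by simp [hT₀]⟩
  rw [mem_filter] at hT'
  refine ⟨T', hT'.2, fun i hi hpi => ?_⟩
  by_contra hiT'
  obtain ⟨D, hD, -, hle⟩ := exists_exchange hs ht hi hiT'
  have hsum := sum_sdiff (f := p') (show D ⊆ insert i T' by grind)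
  rw [sum_insert hiT'] at hsum
  have hsum' : ∑ x ∈ T.erase i ∪ D, p x = ∑ x ∈ T.erase i, p x + ∑ x ∈ D, p x :=
    sum_union (by rw [Finset.disjoint_left]; grind)
  have herase := add_sum_erase T p hi
  have hDle : ∑ x ∈ D, p x ≤ ∑ x ∈ D, p' x := sum_le_sum fun x _ => hpp x
  have hdem : Demands v p' (insert i T' \ D) := by
    intro W
    have h₁ := hT'.2 W
    have h₂ := hT (T.erase i ∪ D)
    simp only [qUtil] at *
    linarith
  have hcard := hmax _ (mem_filter.2 ⟨mem_univ _, hdem⟩)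
  refine absurd hcard (not_le.2 (card_lt_card ⟨fun x hx => ?_, fun h => ?_⟩))
  · simp only [mem_filter, mem_inter, mem_sdiff, mem_insert] at hx ⊢
    refine ⟨⟨hx.1.1, Or.inr hx.1.2, fun hxD => ?_⟩, hx.2⟩
    exact (mem_sdiff.1 (hD hxD)).2 hx.1.1
  · have := h (show i ∈ _ by
      simp only [mem_filter, mem_inter, mem_sdiff, mem_insert]
      exact ⟨⟨hi, Or.inl trivial, fun hxD => (mem_sdiff.1 (hD hxD)).2 hi⟩, hpi⟩)
    simp [hiT'] at this

/-- If two demanded sets differ by two items `i`, `j` of the first, then raising the price of `i`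
reveals a demanded set that separates `j` from `i`. -/
lemma GrossSubstitutes.exists_separating (hv : GrossSubstitutes v) {p : S → ℝ} {T U : Finset S}
    {i j : S} (hT : Demands v p T) (hU : Demands v p U) (hjT : j ∈ T)
    (hiU : i ∉ U) (hij : i ≠ j) : ∃ W, Demands v p W ∧ j ∈ W ∧ i ∉ W := by
  set p' := Function.update p i (p i + 1) with hp'
  have hle : ∀ x, p x ≤ p' x := by
    intro x
    by_cases hx : x = i
    · subst hx; simp [hp']
    · simp [hp', hx]
  have hsame : ∀ W : Finset S, i ∉ W → qUtil v p' W = qUtil v p W := by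
    intro W hW
    simp only [qUtil]
    congr 1
    exact sum_congr rfl fun x hx => by
      rw [hp', Function.update_of_ne]; rintro rfl; exact hW hx
  obtain ⟨W, hW, hkeep⟩ := hv p p' hle T hT
  have hUW : qUtil v p U ≤ qUtil v p' W := by rw [← hsame U hiU]; exact hW U
  have hiW : i ∉ W := by
    intro hiW
    have h₁ := hU W
    have : ∑ x ∈ W, p x < ∑ x ∈ W, p' x :=
      sum_lt_sum (fun x _ => hle x) ⟨i, hiW, by simp [hp']⟩
    simp only [qUtil] at *
    linarith
  refine ⟨W, fun V => ?_, hkeep j hjT (by simp [hp', hij.symm]), hiW⟩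
  rw [← hsame W hiW]
  exact (hU V).trans hUW

/-- Prices can be changed on `A` and outside `A ∪ I` so that only sets between `A` and `A ∪ I`
are competitive. -/
lemma exists_price_interval [Fintype S] (v : Finset S → ℝ) (p : S → ℝ) {A I : Finset S}
    (hAI : Disjoint A I) :
    ∃ q : S → ℝ, (∀ x ∈ I, q x = p x) ∧
      ∀ T : Finset S, ¬(A ⊆ T ∧ T ⊆ A ∪ I) → qUtil v q T < qUtil v q A := by
  obtain ⟨W, hW⟩ := exists_demands v p
  set K := qUtil v p W - qUtil v p A + 1 with hK
  have hK0 : 0 < K := by have := hW A; linarith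
  refine ⟨fun x => p x - (if x ∈ A then K else 0) + (if x ∉ A ∪ I then K else 0), ?_, ?_⟩
  · intro x hx
    have hxA : x ∉ A := fun h => (Finset.disjoint_left.1 hAI) h hx
    simp [hx, hxA]
  intro T hT
  have hsum : ∀ T : Finset S,
      ∑ x ∈ T, (p x - (if x ∈ A then K else 0) + (if x ∉ A ∪ I then K else 0)) =
        ∑ x ∈ T, p x - (T ∩ A).card * K + (T \ (A ∪ I)).card * K := by
    intro T
    rw [sum_add_distrib, sum_sub_distrib, ← sum_filter, ← sum_filter, sum_const, sum_const,
      nsmul_eq_mul, nsmul_eq_mul, filter_mem_eq_inter, filter_notMem_eq_sdiff]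
  have hcard : (T ∩ A).card + 1 ≤ A.card + (T \ (A ∪ I)).card := by
    by_cases hAT : A ⊆ T
    · have : (T \ (A ∪ I)).Nonempty :=
        sdiff_nonempty.2 fun h => hT ⟨hAT, h⟩
      have := card_pos.2 this
      have := card_le_card (inter_subset_right : T ∩ A ⊆ A)
      omega
    · have : (T ∩ A).card < A.card :=
        card_lt_card ⟨inter_subset_right, fun h => hAT (h.trans inter_subset_left)⟩
      omega
  have hcard' : ((T ∩ A).card : ℝ) + 1 ≤ A.card + (T \ (A ∪ I)).card := by exact_mod_cast hcard
  have hA : A \ (A ∪ I) = ∅ := by simp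
  have hmul := mul_le_mul_of_nonneg_right hcard' hK0.le
  have hWT := hW T
  simp only [qUtil, hsum, inter_self, hA, card_empty, Nat.cast_zero, zero_mul] at *
  linarith

lemma GrossSubstitutes.pairSubmodular [Fintype S] (hv : GrossSubstitutes v) :
    PairSubmodular v := by
  intro A i j hi hj hij
  by_contra! hcon
  set a := v (insert i A)
  set b := v (insert j A)
  set e := v A
  set c := v (insert i (insert j A))
  obtain ⟨q, hq, hout⟩ := exists_price_interval v
    (fun x => if x = i then (c + a - b - e) / 2 else (c + b - a - e) / 2)
    (A := A) (I := {i, j}) (by simp [hi, hj])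
  have hqi : q i = (c + a - b - e) / 2 := by simp [hq i (by simp)]
  have hqj : q j = (c + b - a - e) / 2 := by simp [hq j (by simp), hij.symm]
  have ui := qUtil_insert v q hi
  have uj := qUtil_insert v q hj
  have uij := qUtil_insert_insert v q hi hj hij
  have uA : qUtil v q A = e - ∑ x ∈ A, q x := rfl
  have hin : ∀ T : Finset S, A ⊆ T → T ⊆ A ∪ {i, j} →
      T = A ∨ T = insert i A ∨ T = insert j A ∨ T = insert i (insert j A) := by
    intro T h₁ h₂
    by_cases hiT : i ∈ T <;> by_cases hjT : j ∈ T <;> grind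
  have hdem : ∀ T, qUtil v q T ≤ qUtil v q A := by
    intro T
    by_cases hT : A ⊆ T ∧ T ⊆ A ∪ {i, j}
    · rcases hin T hT.1 hT.2 with rfl | rfl | rfl | rfl <;> linarith
    · exact (hout T hT).le
  obtain ⟨W, hW, hjW, hiW⟩ := hv.exists_separating (T := insert i (insert j A)) (U := A)
    (i := i) (j := j) (fun T => (hdem T).trans (by linarith)) hdem (by simp) hi hij
  have hWA := hW A
  by_cases hT : A ⊆ W ∧ W ⊆ A ∪ {i, j}
  · rcases hin W hT.1 hT.2 with rfl | rfl | rfl | rfl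
    · exact hj hjW
    · simp at hiW
    · linarith
    · simp at hiW
  · linarith [hout W hT]

lemma eq_of_subset_union_triple {A T : Finset S} {i j k : S} (h₁ : A ⊆ T)
    (h₂ : T ⊆ A ∪ {i, j, k}) :
    T = A ∨ T = insert i A ∨ T = insert j A ∨ T = insert k A ∨ T = insert i (insert j A) ∨
      T = insert i (insert k A) ∨ T = insert j (insert k A) ∨
      T = insert i (insert j (insert k A)) := by
  by_cases hi : i ∈ T <;> by_cases hj : j ∈ T <;> by_cases hk : k ∈ T
  · iterate 7 right
    grind
  · iterate 4 right
    left; grind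
  · iterate 5 right
    left; grind
  · right; left; grind
  · iterate 6 right
    left; grind
  · iterate 2 right
    left; grind
  · iterate 3 right
    left; grind
  · left; grind

lemma GrossSubstitutes.tripleExchange [Fintype S] (hv : GrossSubstitutes v) :
    TripleExchange v := by
  intro A i j k hi hj hk hij hik hjk
  by_contra! hcon
  obtain ⟨hcon₁, hcon₂⟩ := hcon
  have hs₁ := hv.pairSubmodular A i j hi hj hij
  have hs₂ := hv.pairSubmodular (insert k A) i j (by simp [hi, hik]) (by simp [hj, hjk]) hij
  set a := v (insert i A)
  set b := v (insert j A)
  set c := v (insert k A)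
  set ab := v (insert i (insert j A))
  set ac := v (insert i (insert k A))
  set bc := v (insert j (insert k A))
  -- common utility level of the two optimal sets, relative to the cost of `A`
  set L := (a + b - ac - bc + 2 * c) / 2 with hL
  set ε := (ab + c - bc - a) / 2 with hε
  obtain ⟨q, hq, hout⟩ := exists_price_interval v
    (fun x => if x = i then a - L + ε else if x = j then ab - a - ε else c - L)
    (A := A) (I := {i, j, k}) (by simp [hi, hj, hk])
  have hqi : q i = a - L + ε := by simp [hq i (by simp)]
  have hqj : q j = ab - a - ε := by simp [hq j (by simp), hij.symm]
  have hqk : q k = c - L := by simp [hq k (by simp), hik.symm, hjk.symm]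
  have ui := qUtil_insert v q hi
  have uj := qUtil_insert v q hj
  have uk := qUtil_insert v q hk
  have uij := qUtil_insert_insert v q hi hj hij
  have uik := qUtil_insert_insert v q hi hk hik
  have ujk := qUtil_insert_insert v q hj hk hjk
  have uijk : qUtil v q (insert i (insert j (insert k A))) =
      v (insert i (insert j (insert k A))) - q i - q j - q k - ∑ x ∈ A, q x := by
    rw [qUtil_insert_insert v q (by simp [hi, hik]) (by simp [hj, hjk]) hij, sum_insert hk]
    ring
  have uA : qUtil v q A = v A - ∑ x ∈ A, q x := rfl
  have hdem : ∀ T, qUtil v q T ≤ qUtil v q (insert k A) := by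
    intro T
    by_cases hT : A ⊆ T ∧ T ⊆ A ∪ {i, j, k}
    · rcases eq_of_subset_union_triple hT.1 hT.2 with rfl | rfl | rfl | rfl | rfl | rfl | rfl | rfl <;> linarith
    · linarith [hout T hT]
  obtain ⟨W, hW, hjW, hiW⟩ := hv.exists_separating (T := insert i (insert j A)) (U := insert k A)
    (i := i) (j := j) (fun T => (hdem T).trans (by linarith)) hdem (by simp) (by simp [hi, hik]) hij
  have hWk := hW (insert k A)
  by_cases hT : A ⊆ W ∧ W ⊆ A ∪ {i, j, k}
  · rcases eq_of_subset_union_triple hT.1 hT.2 with rfl | rfl | rfl | rfl | rfl | rfl | rfl | rfl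
    · exact hj hjW
    · simp at hiW
    · linarith
    · simp [hj, hjk] at hjW
    · simp at hiW
    · simp at hiW
    · linarith
    · simp at hiW
  · linarith [hout W hT, hdem A]

lemma GrossSubstitutes.add_card [Fintype S] (hv : GrossSubstitutes v) {f : ℕ → ℝ}
    (hf : ∀ n, f (n + 2) + f n ≤ 2 * f (n + 1)) : GrossSubstitutes fun T => v T + f T.card :=
  grossSubstitutes_of_local (hv.pairSubmodular.add_card hf) (hv.tripleExchange.add_card f)

end

/-- The function of the cardinality that increases with slope `a` up to `ℓ` and with slope `a - M`
afterwards. -/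
noncomputable def capacityReward (ℓ : ℕ) (a M : ℝ) (n : ℕ) : ℝ :=
  a * n - if n ≤ ℓ then 0 else M * ((n : ℝ) - ℓ)

lemma capacityReward_concave (ℓ : ℕ) (a : ℝ) {M : ℝ} (hM : 0 ≤ M) (n : ℕ) :
    capacityReward ℓ a M (n + 2) + capacityReward ℓ a M n ≤
      2 * capacityReward ℓ a M (n + 1) := by
  simp only [capacityReward]
  push_cast
  rcases lt_trichotomy (n + 1) ℓ with h | h | h
  · rw [if_pos (by omega : n + 2 ≤ ℓ), if_pos (by omega : n ≤ ℓ), if_pos h.le]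
    linarith
  · rw [if_neg (by omega : ¬n + 2 ≤ ℓ), if_pos (by omega : n ≤ ℓ), if_pos h.le, ← h]
    push_cast
    linarith
  · rw [if_neg (by omega : ¬n + 2 ≤ ℓ), if_neg (by omega : ¬n + 1 ≤ ℓ)]
    split_ifs with h'
    · obtain rfl : n = ℓ := by omega
      linarith
    · linarith

/-- Adding a size-`ℓ` capacity penalty (or a shifted reward up to size `ℓ`) preserves
gross substitutes. -/
theorem capacity_constraint_preserves_grossSubstitutes
    [Fintype S] [DecidableEq S] (v : Finset S → ℝ) (hv : GrossSubstitutes v)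
    (ℓ : ℕ) (M : ℝ) (hM : 0 ≤ M) :
    GrossSubstitutes
      (fun T : Finset S => if T.card ≤ ℓ then v T else v T - M * ((T.card : ℝ) - ℓ)) ∧
    GrossSubstitutes
      (fun T : Finset S => if T.card ≤ ℓ then v T + M * T.card
        else v T + M * ℓ - M * ((T.card : ℝ) - ℓ)) := by
  constructor
  · convert hv.add_card (capacityReward_concave ℓ 0 hM) using 2 with T
    rw [capacityReward]
    split_ifs <;> ring
  · convert hv.add_card (capacityReward_concave ℓ M (M := 2 * M) (by positivity)) using 2 with T
    rw [capacityReward]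
    split_ifs <;> ring
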